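/- An integral domain R (not a field) has the w-basic ideal property (every nonzero ideal of R is w-basic) if and only if R is a Prüfer v-multiplication domain of t-dimension 1, i.e., a PvMD in which every maximal t-ideal has height 1. -/

import Mathlib

open scoped nonZeroDivisors

section

variable {R : Type*} (K : Type*) [CommRing R] [IsDomain R] [Field K]
  [Algebra R K] [IsFractionRing R K]

/-- The `t`-operation on (nonzero) fractional ideals of `R`:
`I_t = ⋃ J_v`, where `J` ranges over the nonzero finitely generated subideals of `I` and
`J_v = (J⁻¹)⁻¹` (realized as a supremum of `R`-submodules of `K`). -/
noncomputable def tOp (I : FractionalIdeal R⁰ K) : Submodule R K :=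
  ⨆ (J : FractionalIdeal R⁰ K) (_ : J ≠ 0) (_ : J ≤ I) (_ : (J : Submodule R K).FG),
    (((J⁻¹)⁻¹ : FractionalIdeal R⁰ K) : Submodule R K)

/-- An integral ideal `M` of `R` is a `t`-ideal if `M_t = M`. -/
def IsTIdeal (M : Ideal R) : Prop :=
  tOp K (M : FractionalIdeal R⁰ K) = ((M : FractionalIdeal R⁰ K) : Submodule R K)

/-- `M` is a maximal `t`-ideal of `R`: maximal among the proper integral `t`-ideals. -/
def IsMaxTIdeal (M : Ideal R) : Prop :=
  M ≠ ⊤ ∧ IsTIdeal K M ∧ ∀ N : Ideal R, N ≠ ⊤ → IsTIdeal K N → M ≤ N → M = N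

/-- The extension `A·R_M` of an `R`-submodule `A` of `K` to the localization `R_M ⊆ K`
(for `M` a prime ideal of `R`): the set of fractions `a/t` with `a ∈ A`, `t ∉ M`. -/
noncomputable def locMul (M : Ideal R) (A : Submodule R K) : Submodule R K :=
  ⨆ (t : R) (_ : t ∉ M), Submodule.span R {(algebraMap R K t)⁻¹} * A

/-- The `w`-operation: `I_w = ⋂ I·R_M`, the intersection taken over all maximal `t`-ideals
`M` of `R`. -/
noncomputable def wOp (I : FractionalIdeal R⁰ K) : Submodule R K :=
  ⨅ (M : Ideal R) (_ : IsMaxTIdeal K M), locMul K M (I : Submodule R K)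

/-- `R` is a Prüfer `v`-multiplication domain: every nonzero finitely generated ideal is
`t`-invertible. -/
def IsPvMD : Prop :=
  ∀ I : Ideal R, I ≠ ⊥ → I.FG →
    tOp K ((I : FractionalIdeal R⁰ K) * (I : FractionalIdeal R⁰ K)⁻¹) = 1

end

set_option linter.unusedSectionVars false

section TPart

variable {R : Type*} (K : Type*) [CommRing R] [IsDomain R] [Field K]
  [Algebra R K] [IsFractionRing R K]

def vcl (J : Ideal R) (z : R) : Prop :=
  ∀ f : K, (∀ y ∈ J, ∃ r : R, algebraMap R K r = f * algebraMap R K y) →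
    ∃ r : R, algebraMap R K r = f * algebraMap R K z

theorem vcl_self {J : Ideal R} {z : R} (h : z ∈ J) : vcl K J z := fun _ hf => hf z h

theorem vcl_mono {J J' : Ideal R} (h : J ≤ J') {z : R} (hz : vcl K J z) : vcl K J' z :=
  fun f hf => hz f fun y hy => hf y (h hy)

theorem vcl_trans {J J' : Ideal R} (h : ∀ y ∈ J, vcl K J' y) {z : R} (hz : vcl K J z) :
    vcl K J' z :=
  fun f hf => hz f fun y hy => h y hy f hf

theorem vcl_add {J : Ideal R} {x y : R} (hx : vcl K J x) (hy : vcl K J y) :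
    vcl K J (x + y) := by
  intro f hf
  obtain ⟨r, hr⟩ := hx f hf
  obtain ⟨s, hs⟩ := hy f hf
  exact ⟨r + s, by rw [map_add, map_add, hr, hs]; ring⟩

theorem vcl_smul {J : Ideal R} (c : R) {x : R} (hx : vcl K J x) : vcl K J (c * x) := by
  intro f hf
  obtain ⟨r, hr⟩ := hx f hf
  exact ⟨c * r, by rw [map_mul, map_mul, hr]; ring⟩

theorem vcl_zero (J : Ideal R) : vcl K J 0 := fun f _ => ⟨0, by simp⟩

/-- t-closure as an ideal -/
def tcl (A : Ideal R) : Ideal R where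
  carrier := {z | z = 0 ∨ ∃ J : Ideal R, J.FG ∧ J ≠ ⊥ ∧ J ≤ A ∧ vcl K J z}
  zero_mem' := Or.inl rfl
  add_mem' := by
    rintro x y (rfl | ⟨J, hJ, hJ0, hJA, hx⟩) (rfl | ⟨J', hJ', hJ0', hJA', hy⟩)
    · left; simp
    · right; exact ⟨J', hJ', hJ0', hJA', by simpa using hy⟩
    · right; exact ⟨J, hJ, hJ0, hJA, by simpa using hx⟩
    · right
      refine ⟨J ⊔ J', Submodule.FG.sup hJ hJ', ?_, sup_le hJA hJA', vcl_add K (vcl_mono K le_sup_left hx)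
        (vcl_mono K le_sup_right hy)⟩
      intro h
      exact hJ0 (le_bot_iff.1 (h ▸ le_sup_left))
  smul_mem' := by
    rintro c x (rfl | ⟨J, hJ, hJ0, hJA, hx⟩)
    · left; simp
    · right; exact ⟨J, hJ, hJ0, hJA, vcl_smul K c hx⟩

theorem mem_tcl {A : Ideal R} {z : R} :
    z ∈ tcl K A ↔ z = 0 ∨ ∃ J : Ideal R, J.FG ∧ J ≠ ⊥ ∧ J ≤ A ∧ vcl K J z := Iff.rfl

theorem mem_vv {J : Ideal R} (hJ : J ≠ ⊥) (z : K) :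
    z ∈ (((J : FractionalIdeal R⁰ K)⁻¹)⁻¹) ↔ ∃ r : R, algebraMap R K r = z ∧ vcl K J r := by
  have hJ0 : (J : FractionalIdeal R⁰ K) ≠ 0 := FractionalIdeal.coeIdeal_ne_zero.2 hJ
  have h1 : (1 : K) ∈ (J : FractionalIdeal R⁰ K)⁻¹ := by
    rw [FractionalIdeal.mem_inv_iff hJ0]
    intro y hy
    obtain ⟨x, -, rfl⟩ := (FractionalIdeal.mem_coeIdeal _).1 hy
    simp
  have hJ1 : (J : FractionalIdeal R⁰ K)⁻¹ ≠ 0 := by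
    intro h
    rw [h] at h1
    simp at h1
  have key : ∀ f : K, f ∈ (J : FractionalIdeal R⁰ K)⁻¹ ↔
      ∀ y ∈ J, ∃ r : R, algebraMap R K r = f * algebraMap R K y := by
    intro f
    rw [FractionalIdeal.mem_inv_iff hJ0]
    constructor
    · intro h y hy
      exact (FractionalIdeal.mem_one_iff _).1 (h _ (FractionalIdeal.mem_coeIdeal_of_mem _ hy))
    · intro h y hy
      obtain ⟨x, hx, rfl⟩ := (FractionalIdeal.mem_coeIdeal _).1 hy
      exact (FractionalIdeal.mem_one_iff _).2 (h x hx)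
  rw [FractionalIdeal.mem_inv_iff hJ1]
  constructor
  · intro h
    obtain ⟨r, hr⟩ := (FractionalIdeal.mem_one_iff _).1 (h 1 h1)
    rw [mul_one] at hr
    refine ⟨r, hr, fun f hf => ?_⟩
    obtain ⟨s, hs⟩ := (FractionalIdeal.mem_one_iff _).1 (h f ((key f).2 hf))
    exact ⟨s, by rw [hs, hr]; ring⟩
  · rintro ⟨r, rfl, hr⟩ f hf
    obtain ⟨s, hs⟩ := hr f ((key f).1 hf)
    exact (FractionalIdeal.mem_one_iff _).2 ⟨s, by rw [hs]; ring⟩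

theorem tOp_eq (A : Ideal R) : tOp K (A : FractionalIdeal R⁰ K) =
    (((tcl K A : Ideal R) : FractionalIdeal R⁰ K) : Submodule R K) := by
  apply le_antisymm
  · unfold tOp
    refine iSup_le fun J => iSup_le fun hJ0 => iSup_le fun hJA => iSup_le fun hJ => ?_
    obtain ⟨J', rfl⟩ := FractionalIdeal.le_one_iff_exists_coeIdeal.1
      (hJA.trans FractionalIdeal.coeIdeal_le_one)
    have hJ0' : J' ≠ ⊥ := FractionalIdeal.coeIdeal_ne_zero.1 hJ0
    intro z hz
    obtain ⟨r, rfl, hr⟩ := (mem_vv K hJ0' z).1 hz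
    refine FractionalIdeal.mem_coeIdeal_of_mem _ ?_
    exact Or.inr ⟨J', (FractionalIdeal.coeIdeal_fg R⁰ (IsFractionRing.injective R K) J').1 hJ, hJ0',
      (FractionalIdeal.coeIdeal_le_coeIdeal K).1 hJA, hr⟩
  · intro z hz
    obtain ⟨r, hr, rfl⟩ := (FractionalIdeal.mem_coeIdeal R⁰).1 hz
    rcases hr with rfl | ⟨J, hJ, hJ0, hJA, hr⟩
    · simp
    · have h1 : algebraMap R K r ∈ ((((J : FractionalIdeal R⁰ K)⁻¹)⁻¹ : FractionalIdeal R⁰ K) :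
          Submodule R K) := (mem_vv K hJ0 _).2 ⟨r, rfl, hr⟩
      refine (le_iSup_of_le (J : FractionalIdeal R⁰ K) ?_ :
        ((((J : FractionalIdeal R⁰ K)⁻¹)⁻¹ : FractionalIdeal R⁰ K) : Submodule R K) ≤ _) h1
      refine le_iSup_of_le (FractionalIdeal.coeIdeal_ne_zero.2 hJ0) ?_
      refine le_iSup_of_le ((FractionalIdeal.coeIdeal_le_coeIdeal K).2 hJA) ?_
      exact le_iSup_of_le
        ((FractionalIdeal.coeIdeal_fg R⁰ (IsFractionRing.injective R K) J).2 hJ) le_rfl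

theorem isTIdeal_iff (M : Ideal R) : IsTIdeal K M ↔ tcl K M = M := by
  unfold IsTIdeal
  rw [tOp_eq]
  constructor
  · intro h
    exact FractionalIdeal.coeIdeal_injective (FractionalIdeal.coeToSubmodule_injective h)
  · intro h
    rw [h]

theorem le_tcl (A : Ideal R) : A ≤ tcl K A := by
  intro x hx
  by_cases h : x = 0
  · exact Or.inl h
  · exact Or.inr ⟨Ideal.span {x}, Submodule.fg_span_singleton x, by simpa using h,
      by simpa using hx, vcl_self K (Ideal.mem_span_singleton_self x)⟩

theorem isTIdeal_iff' (M : Ideal R) : IsTIdeal K M ↔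
    ∀ J : Ideal R, J.FG → J ≠ ⊥ → J ≤ M → ∀ z, vcl K J z → z ∈ M := by
  rw [isTIdeal_iff]
  constructor
  · intro h J hJ hJ0 hJM z hz
    rw [← h]
    exact Or.inr ⟨J, hJ, hJ0, hJM, hz⟩
  · intro h
    refine le_antisymm ?_ (le_tcl K M)
    rintro z (rfl | ⟨J, hJ, hJ0, hJM, hz⟩)
    · exact M.zero_mem
    · exact h J hJ hJ0 hJM z hz

theorem exists_fg_of_le_tcl {A : Ideal R} (hA : A ≠ ⊥) {J : Ideal R} (hJ : J.FG)
    (h : J ≤ tcl K A) :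
    ∃ F : Ideal R, F.FG ∧ F ≠ ⊥ ∧ F ≤ A ∧ ∀ y ∈ J, vcl K F y := by
  classical
  obtain ⟨S, rfl⟩ := hJ
  induction S using Finset.induction_on with
  | empty =>
    obtain ⟨a, ha, ha0⟩ := Submodule.exists_mem_ne_zero_of_ne_bot hA
    refine ⟨Ideal.span {a}, Submodule.fg_span_singleton a, by simpa using ha0,
      by simpa using ha, ?_⟩
    intro y hy
    simp at hy
    rw [hy]; exact vcl_zero K _
  | insert a S _ ih =>
    obtain ⟨F, hF, hF0, hFA, hv⟩ := ih (le_trans (Submodule.span_mono (by simp)) h)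
    have ha : a ∈ tcl K A := h (Submodule.subset_span (by simp))
    have key : ∃ F' : Ideal R, F'.FG ∧ F' ≠ ⊥ ∧ F' ≤ A ∧ F ≤ F' ∧ vcl K F' a := by
      rcases ha with rfl | ⟨G, hG, hG0, hGA, hz⟩
      · exact ⟨F, hF, hF0, hFA, le_rfl, vcl_zero K _⟩
      · refine ⟨F ⊔ G, Submodule.FG.sup hF hG, ?_, sup_le hFA hGA, le_sup_left, vcl_mono K le_sup_right hz⟩
        intro h
        exact hF0 (le_bot_iff.1 (h ▸ le_sup_left))
    obtain ⟨F', h1, h2, h3, h4, h5⟩ := key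
    refine ⟨F', h1, h2, h3, fun y hy => ?_⟩
    rw [Finset.coe_insert, Submodule.mem_span_insert] at hy
    obtain ⟨c, z, hz, rfl⟩ := hy
    exact vcl_add K (vcl_smul K c h5) (vcl_mono K h4 (hv z hz))

theorem tcl_isT (A : Ideal R) (hA : A ≠ ⊥) : IsTIdeal K (tcl K A) := by
  rw [isTIdeal_iff']
  intro J hJ hJ0 hJA z hz
  obtain ⟨F, h1, h2, h3, h4⟩ := exists_fg_of_le_tcl K hA hJ hJA
  exact Or.inr ⟨F, h1, h2, h3, vcl_trans K h4 hz⟩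

theorem tcl_le {A M : Ideal R} (h : A ≤ M) (hM : IsTIdeal K M) : tcl K A ≤ M := by
  rw [isTIdeal_iff'] at hM
  rintro z (rfl | ⟨J, hJ, hJ0, hJM, hz⟩)
  · exact M.zero_mem
  · exact hM J hJ hJ0 (hJM.trans h) z hz

theorem exists_maxT (A : Ideal R) (hA : A ≠ ⊤) (hT : IsTIdeal K A) :
    ∃ M : Ideal R, IsMaxTIdeal K M ∧ A ≤ M := by
  obtain ⟨M, hAM, hM⟩ := zorn_le_nonempty₀ {N : Ideal R | N ≠ ⊤ ∧ IsTIdeal K N} (by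
    intro c hc hchain y hy
    have hdir : DirectedOn (· ≤ ·) c := hchain.directedOn
    refine ⟨sSup c, ⟨?_, ?_⟩, fun z hz => le_sSup hz⟩
    · intro h
      have : (1 : R) ∈ sSup c := h ▸ Submodule.mem_top
      obtain ⟨N, hN, h1⟩ := (Submodule.mem_sSup_of_directed ⟨y, hy⟩ hdir).1 this
      exact (hc hN).1 ((Ideal.eq_top_iff_one _).2 h1)
    · rw [isTIdeal_iff']
      intro J hJ hJ0 hJc z hz
      have hcomp := (Submodule.fg_iff_compact J).1 hJ
      obtain ⟨N, hN, hJN⟩ := (CompleteLattice.isCompactElement_iff_le_of_directed_sSup_le _ _).1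
        hcomp c ⟨y, hy⟩ hdir hJc
      exact (le_sSup hN : N ≤ sSup c) ((isTIdeal_iff' K N).1 (hc hN).2 J hJ hJ0 hJN z hz)) A ⟨hA, hT⟩
  refine ⟨M, ⟨hM.1.1, hM.1.2, fun N hN hNT hMN => ?_⟩, hAM⟩
  exact le_antisymm hMN (hM.2 ⟨hN, hNT⟩ hMN)

theorem span_singleton_isT (a : R) (ha : a ≠ 0) : IsTIdeal K (Ideal.span {a}) := by
  rw [isTIdeal_iff']
  intro J hJ hJ0 hJa z hz
  have ha' : algebraMap R K a ≠ 0 := by simpa using ha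
  obtain ⟨r, hr⟩ := hz (algebraMap R K a)⁻¹ (by
    intro y hy
    obtain ⟨c, rfl⟩ := Ideal.mem_span_singleton'.1 (hJa hy)
    refine ⟨c, ?_⟩
    rw [map_mul]; field_simp)
  rw [Ideal.mem_span_singleton']
  refine ⟨r, IsFractionRing.injective R K ?_⟩
  rw [map_mul, hr]; field_simp

theorem maxT_ne_bot (hnf : ¬ IsField R) {M : Ideal R} (hM : IsMaxTIdeal K M) : M ≠ ⊥ := by
  rintro rfl
  obtain ⟨a, ha0, hau⟩ := Ring.not_isField_iff_exists_ideal_bot_lt_and_lt_top.1 hnf |>.elim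
    fun I hI => by
      obtain ⟨a, ha, ha0⟩ := Submodule.exists_mem_ne_zero_of_ne_bot hI.1.ne'
      exact (⟨a, ha0, fun hu => hI.2.ne (Ideal.eq_top_of_isUnit_mem _ ha hu)⟩ :
        ∃ a : R, a ≠ 0 ∧ ¬ IsUnit a)
  have := hM.2.2 (Ideal.span {a}) (by rwa [Ne, Ideal.span_singleton_eq_top])
    (span_singleton_isT K a ha0) bot_le
  exact ha0 (by simpa using this.symm)

theorem maxT_isPrime {M : Ideal R} (hM : IsMaxTIdeal K M) : M.IsPrime := by
  refine ⟨hM.1, ?_⟩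
  intro a b hab
  by_contra! hcon
  obtain ⟨ha, hb⟩ := hcon
  have hb0 : b ≠ 0 := fun h => hb (h ▸ M.zero_mem)
  have ha0 : a ≠ 0 := fun h => ha (h ▸ M.zero_mem)
  have hne : M ⊔ Ideal.span {a} ≠ ⊥ := by
    intro h
    have : Ideal.span {a} ≤ (⊥ : Ideal R) := h ▸ le_sup_right
    exact ha0 (by simpa using this)
  have htop : tcl K (M ⊔ Ideal.span {a}) = ⊤ := by
    by_contra hne'
    have := hM.2.2 _ hne' (tcl_isT K _ hne) (le_sup_left.trans (le_tcl K _))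
    apply ha
    rw [this]
    exact le_tcl K _ (le_sup_right (a := M) (Ideal.mem_span_singleton_self a))
  have h1 : (1 : R) ∈ tcl K (M ⊔ Ideal.span {a}) := htop ▸ Submodule.mem_top
  rcases h1 with h1 | ⟨J, hJ, hJ0, hJA, hz⟩
  · exact one_ne_zero h1
  · apply hb
    refine (isTIdeal_iff' K M).1 hM.2.1 (Ideal.span {b} * J)
      (Submodule.FG.mul (Submodule.fg_span_singleton b) hJ) ?_ ?_ b ?_
    · intro h
      rcases Ideal.mul_eq_bot.1 h with h | h
      · exact hb0 (by simpa using h)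
      · exact hJ0 h
    · rw [Ideal.span_singleton_mul_le_iff]
      intro z hzJ
      obtain ⟨m, hm, c, hc, rfl⟩ := Submodule.mem_sup.1 (hJA hzJ)
      obtain ⟨d, rfl⟩ := Ideal.mem_span_singleton'.1 hc
      have : b * (m + d * a) = b * m + d * (a * b) := by ring
      rw [this]
      exact M.add_mem (M.mul_mem_left _ hm) (M.mul_mem_left _ hab)
    · intro f hf
      obtain ⟨r, hr⟩ := hz (f * algebraMap R K b) (by
        intro y hy
        obtain ⟨r, hr⟩ := hf (b * y) (Ideal.mul_mem_mul (Ideal.mem_span_singleton_self b) hy)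
        exact ⟨r, by rw [hr, map_mul]; ring⟩)
      exact ⟨r, by rw [hr]; simp⟩

theorem isPvMD_of_val (hnf : ¬ IsField R)
    (h : ∀ M : Ideal R, IsMaxTIdeal K M → ∀ a b : R,
      (∃ s, s ∉ M ∧ ∃ c, s * b = a * c) ∨ (∃ s, s ∉ M ∧ ∃ c, s * a = b * c)) :
    IsPvMD (R := R) K := by
  intro I hI hfg
  have hI0 : (I : FractionalIdeal R⁰ K) ≠ 0 := FractionalIdeal.coeIdeal_ne_zero.2 hI
  obtain ⟨B, hB⟩ := FractionalIdeal.le_one_iff_exists_coeIdeal.1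
    (FractionalIdeal.mul_one_div_le_one : (I : FractionalIdeal R⁰ K) * (1 / I) ≤ 1)
  rw [← FractionalIdeal.inv_eq] at hB
  rw [← hB, tOp_eq]
  suffices hs : tcl K B = ⊤ by rw [hs]; simp
  by_contra hne
  have hB0 : B ≠ ⊥ := by
    rintro rfl
    obtain ⟨a, ha, ha0⟩ := Submodule.exists_mem_ne_zero_of_ne_bot hI
    have h1 : (1 : K) ∈ (I : FractionalIdeal R⁰ K)⁻¹ := by
      rw [FractionalIdeal.mem_inv_iff hI0]
      intro y hy
      obtain ⟨x, -, rfl⟩ := (FractionalIdeal.mem_coeIdeal _).1 hy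
      simp
    have h2 := FractionalIdeal.mul_mem_mul
      (FractionalIdeal.mem_coeIdeal_of_mem (S := R⁰) (P := K) ha) h1
    rw [← hB] at h2
    simp at h2
    exact ha0 h2
  obtain ⟨M, hM, hBM⟩ := exists_maxT K _ hne (tcl_isT K B hB0)
  have hMp := maxT_isPrime K hM
  -- local generator
  have gen : ∃ a ∈ I, ∃ s, s ∉ M ∧ ∀ x ∈ I, ∃ c, s * x = a * c := by
    clear hB hB0 hI0 hI
    obtain ⟨S, rfl⟩ := hfg
    classical
    induction S using Finset.induction_on with
    | empty =>
      refine ⟨0, by simp, 1, fun h => hM.1 ((Ideal.eq_top_iff_one _).2 h), fun x hx => ⟨0, ?_⟩⟩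
      simpa using hx
    | insert b S _ ih =>
      obtain ⟨a, ha, s, hs, hx⟩ := ih
      rcases h M hM a b with ⟨t, ht, c, hc⟩ | ⟨t, ht, c, hc⟩
      · refine ⟨a, Submodule.span_mono (by simp) ha, s * t, fun h => ?_, ?_⟩
        · rcases hMp.mem_or_mem h with h | h <;> contradiction
        · intro x hx'
          rw [Finset.coe_insert, Submodule.mem_span_insert] at hx'
          obtain ⟨d, z, hz, rfl⟩ := hx'
          obtain ⟨e, he⟩ := hx z hz
          refine ⟨s * d * c + t * e, ?_⟩
          simp only [smul_eq_mul]
          linear_combination s * d * hc + t * he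
      · refine ⟨b, Submodule.subset_span (by simp), s * t, fun h => ?_, ?_⟩
        · rcases hMp.mem_or_mem h with h | h <;> contradiction
        · intro x hx'
          rw [Finset.coe_insert, Submodule.mem_span_insert] at hx'
          obtain ⟨d, z, hz, rfl⟩ := hx'
          obtain ⟨e, he⟩ := hx z hz
          refine ⟨s * t * d + c * e, ?_⟩
          simp only [smul_eq_mul]
          linear_combination t * he + e * hc
  obtain ⟨a, ha, s, hs, hx⟩ := gen
  have ha0 : a ≠ 0 := by
    rintro rfl
    obtain ⟨x, hxI, hx0⟩ := Submodule.exists_mem_ne_zero_of_ne_bot hI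
    obtain ⟨c, hc⟩ := hx x hxI
    rw [zero_mul] at hc
    rcases mul_eq_zero.1 hc with h | h
    · exact hs (h ▸ M.zero_mem)
    · exact hx0 h
  have ha' : algebraMap R K a ≠ 0 := by simpa using ha0
  have h1 : algebraMap R K s / algebraMap R K a ∈ (I : FractionalIdeal R⁰ K)⁻¹ := by
    rw [FractionalIdeal.mem_inv_iff hI0]
    intro y hy
    obtain ⟨x, hxI, rfl⟩ := (FractionalIdeal.mem_coeIdeal _).1 hy
    obtain ⟨c, hc⟩ := hx x hxI
    refine (FractionalIdeal.mem_one_iff _).2 ⟨c, ?_⟩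
    have := congrArg (algebraMap R K) hc
    rw [map_mul, map_mul] at this
    field_simp
    rw [this]; ring
  have h2 := FractionalIdeal.mul_mem_mul
      (FractionalIdeal.mem_coeIdeal_of_mem (S := R⁰) (P := K) ha) h1
  rw [← hB, mul_div_cancel₀ _ ha'] at h2
  obtain ⟨s', hs', he⟩ := (FractionalIdeal.mem_coeIdeal _).1 h2
  rw [IsFractionRing.injective R K he] at hs'
  exact hs (hBM (le_tcl K _ hs'))

theorem val_of_isPvMD (h : IsPvMD (R := R) K) {M : Ideal R} (hM : IsMaxTIdeal K M) (a b : R) :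
      (∃ s, s ∉ M ∧ ∃ c, s * b = a * c) ∨ (∃ s, s ∉ M ∧ ∃ c, s * a = b * c) := by
  by_cases ha0 : a = 0
  · right
    exact ⟨1, fun h => hM.1 ((Ideal.eq_top_iff_one _).2 h), 0, by simp [ha0]⟩
  set I : Ideal R := Ideal.span {a, b} with hIdef
  have haI : a ∈ I := Ideal.subset_span (by simp)
  have hbI : b ∈ I := Ideal.subset_span (by simp)
  have hI : I ≠ ⊥ := fun h => ha0 (by rw [h] at haI; simpa using haI)
  have hI0 : (I : FractionalIdeal R⁰ K) ≠ 0 := FractionalIdeal.coeIdeal_ne_zero.2 hI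
  have hfg : I.FG := Submodule.fg_span (by simp)
  have ht := h I hI hfg
  obtain ⟨B, hB⟩ := FractionalIdeal.le_one_iff_exists_coeIdeal.1
    (FractionalIdeal.mul_one_div_le_one : (I : FractionalIdeal R⁰ K) * (1 / I) ≤ 1)
  rw [← FractionalIdeal.inv_eq] at hB
  by_contra! hcon
  obtain ⟨hc1, hc2⟩ := hcon
  rw [← hB, tOp_eq] at ht
  have hBM : B ≤ M := by
    rw [← FractionalIdeal.coeIdeal_le_coeIdeal K, hB, FractionalIdeal.mul_le]
    intro i hi f hf
    rw [FractionalIdeal.mem_inv_iff hI0] at hf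
    obtain ⟨x, hx, rfl⟩ := (FractionalIdeal.mem_coeIdeal _).1 hi
    obtain ⟨fa, hfa⟩ := (FractionalIdeal.mem_one_iff _).1
      (hf _ (FractionalIdeal.mem_coeIdeal_of_mem _ haI))
    obtain ⟨fb, hfb⟩ := (FractionalIdeal.mem_one_iff _).1
      (hf _ (FractionalIdeal.mem_coeIdeal_of_mem _ hbI))
    have e : fa * b = a * fb := IsFractionRing.injective R K (by
      rw [map_mul, map_mul, hfa, hfb]; ring)
    have h1 : fa ∈ M := by
      by_contra hn
      exact hc1 fa hn fb e
    have h2 : fb ∈ M := by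
      by_contra hn
      exact hc2 fb hn fa (by rw [mul_comm, ← e, mul_comm])
    obtain ⟨u, v, rfl⟩ := Ideal.mem_span_pair.1 hx
    refine (FractionalIdeal.mem_coeIdeal _).2 ⟨u * fa + v * fb,
      M.add_mem (M.mul_mem_left _ h1) (M.mul_mem_left _ h2), ?_⟩
    simp only [map_add, map_mul, hfa, hfb]; ring
  have h1 := tcl_le K hBM hM.2.1
  have : tcl K B = ⊤ := by
    apply FractionalIdeal.coeIdeal_injective (K := K)
    apply FractionalIdeal.coeToSubmodule_injective
    refine ht.trans ?_
    simp
  rw [this] at h1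
  exact hM.1 (top_le_iff.1 h1)

end TPart

section Sat

variable {R : Type*} [CommRing R] [IsDomain R]

/-- contraction of the extension of `A` to the localization at `M` -/
def sat (M : Ideal R) [hM : M.IsPrime] (A : Ideal R) : Ideal R where
  carrier := {x | ∃ s, s ∉ M ∧ s * x ∈ A}
  zero_mem' := ⟨1, M.one_notMem, by simp⟩
  add_mem' := by
    rintro x y ⟨s, hs, hx⟩ ⟨t, ht, hy⟩
    refine ⟨s * t, M.primeCompl.mul_mem hs ht, ?_⟩
    have : s * t * (x + y) = t * (s * x) + s * (t * y) := by ring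
    rw [this]
    exact A.add_mem (A.mul_mem_left _ hx) (A.mul_mem_left _ hy)
  smul_mem' := by
    rintro c x ⟨s, hs, hx⟩
    refine ⟨s, hs, ?_⟩
    have : s * (c • x) = c * (s * x) := by simp only [smul_eq_mul]; ring
    rw [this]
    exact A.mul_mem_left _ hx

variable (M : Ideal R) [hM : M.IsPrime]

theorem mem_sat {A : Ideal R} {x : R} : x ∈ sat M A ↔ ∃ s, s ∉ M ∧ s * x ∈ A := Iff.rfl

theorem le_sat (A : Ideal R) : A ≤ sat M A := fun x hx => ⟨1, M.one_notMem, by simpa using hx⟩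

theorem sat_le_of {A B : Ideal R} (h : A ≤ sat M B) : sat M A ≤ sat M B := by
  rintro x ⟨s, hs, hx⟩
  obtain ⟨t, ht, hy⟩ := h hx
  exact ⟨t * s, M.primeCompl.mul_mem ht hs, by rwa [mul_assoc]⟩

theorem mul_sat {A B C D : Ideal R} (h1 : A ≤ sat M C) (h2 : B ≤ sat M D) :
    A * B ≤ sat M (C * D) := by
  rw [Ideal.mul_le]
  intro x hx y hy
  obtain ⟨s, hs, hx⟩ := h1 hx
  obtain ⟨t, ht, hy⟩ := h2 hy
  refine ⟨s * t, M.primeCompl.mul_mem hs ht, ?_⟩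
  rw [mul_mul_mul_comm]
  exact Ideal.mul_mem_mul hx hy

theorem pow_sat {A B : Ideal R} (h : A ≤ sat M B) (n : ℕ) : A ^ n ≤ sat M (B ^ n) := by
  induction n with
  | zero => simpa using le_sat M ⊤
  | succ n ih => rw [pow_succ, pow_succ]; exact mul_sat M ih h

theorem arch (h : ∀ P : Ideal R, P.IsPrime → P ≤ M → P ≠ ⊥ → P = M) {c y : R}
    (hc0 : c ≠ 0) (hy : y ∈ M) : ∃ k : ℕ, ∃ s, s ∉ M ∧ ∃ d, s * y ^ k = c * d := by
  by_contra! hcon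
  obtain ⟨P, hP, hcP, hdis⟩ := Ideal.exists_le_prime_disjoint (Ideal.span {c})
    (M.primeCompl ⊔ Submonoid.powers y) (by
      rw [Set.disjoint_left]
      intro x hx hx'
      obtain ⟨s, hs, z, ⟨k, rfl⟩, rfl⟩ := Submonoid.mem_sup.1 hx'
      obtain ⟨d, hd⟩ := Ideal.mem_span_singleton'.1 hx
      exact hcon k s hs d (by rw [← hd]; ring))
  rw [Set.disjoint_left] at hdis
  have hPM : P ≤ M := by
    intro x hx
    by_contra hn
    exact hdis hx ((le_sup_left : M.primeCompl ≤ _) hn)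
  have hyP : y ∉ P := fun hyP => hdis hyP
    ((le_sup_right : Submonoid.powers y ≤ _) (Submonoid.mem_powers y))
  have := h P hP hPM (by
    rintro rfl
    exact hc0 (by simpa using hcP))
  exact hyP (this ▸ hy)

theorem basic_local
    (h : ∀ P : Ideal R, P.IsPrime → P ≤ M → P ≠ ⊥ → P = M)
    (hv : ∀ a b : R, (∃ s, s ∉ M ∧ ∃ c, s * b = a * c) ∨ (∃ s, s ∉ M ∧ ∃ c, s * a = b * c))
    {I J : Ideal R} (n : ℕ) (hIJ : I ^ (n + 1) ≤ sat M (J * I ^ n)) : I ≤ sat M J := by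
  intro a haI
  by_contra haJ
  have ha0 : a ≠ 0 := fun h => haJ (h ▸ Ideal.zero_mem _)
  have hJa : J ≤ sat M (Ideal.span {a}) := by
    intro j hj
    rcases hv a j with ⟨s, hs, c, hc⟩ | ⟨s, hs, c, hc⟩
    · exact ⟨s, hs, Ideal.mem_span_singleton'.2 ⟨c, by rw [hc]; ring⟩⟩
    · exact absurd ⟨s, hs, by rw [hc]; exact J.mul_mem_right _ hj⟩ haJ
  have step : I ^ (n + 1) ≤ sat M (Ideal.span {a} * I ^ n) :=
    hIJ.trans (sat_le_of M (mul_sat M hJa (le_sat M _)))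
  have iter : ∀ k : ℕ, I ^ (n + k) ≤ sat M (Ideal.span {a} ^ k * I ^ n) := by
    intro k
    induction k with
    | zero => simpa using le_sat M (I ^ n)
    | succ k ih =>
      have e : I ^ (n + (k + 1)) = I ^ (n + k) * I := by rw [← add_assoc, pow_succ]
      rw [e]
      refine (mul_sat M ih (le_sat M I)).trans (sat_le_of M ?_)
      rw [mul_assoc, ← pow_succ]
      refine (mul_sat M (le_sat M _) step).trans (sat_le_of M ?_)
      rw [← mul_assoc, ← pow_succ]
      exact le_sat M _
  have hIa : I ≤ sat M (Ideal.span {a}) := by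
    intro b hb
    by_contra hnb
    rcases hv a b with ⟨s, hs, c, hc⟩ | ⟨s0, hs0, y, hy⟩
    · exact hnb ⟨s, hs, Ideal.mem_span_singleton'.2 ⟨c, by rw [hc]; ring⟩⟩
    have hyM : y ∈ M := by
      by_contra hyM
      exact hnb ⟨y, hyM, Ideal.mem_span_singleton'.2 ⟨s0, by rw [hy]; ring⟩⟩
    have hs00 : s0 ≠ 0 := fun h => hs0 (h ▸ M.zero_mem)
    have hb0 : b ≠ 0 := by
      rintro rfl
      rw [zero_mul] at hy
      rcases mul_eq_zero.1 hy with h | h <;> contradiction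
    have hy0 : y ≠ 0 := by
      rintro rfl
      rw [mul_zero] at hy
      rcases mul_eq_zero.1 hy with h | h <;> contradiction
    obtain ⟨k, s2, hs2, d, hd⟩ := arch M h (c := y * b ^ n)
      (mul_ne_zero hy0 (pow_ne_zero _ hb0)) hyM
    obtain ⟨s1, hs1, hmem⟩ := iter k (Ideal.pow_mem_pow hb (n + k))
    rw [Ideal.span_singleton_pow, Ideal.mem_span_singleton_mul] at hmem
    obtain ⟨w, -, hw⟩ := hmem
    have e1 : a ^ k * (s1 * s0 ^ k * b ^ n) = a ^ k * (w * y ^ k) := by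
      have e2 : s0 ^ k * a ^ k = b ^ k * y ^ k := by rw [← mul_pow, hy, mul_pow]
      rw [pow_add] at hw
      linear_combination (s1 * b ^ n) * e2 - y ^ k * hw
    have e3 := mul_left_cancel₀ (pow_ne_zero k ha0) e1
    have e4 : b ^ n * (s2 * (s1 * s0 ^ k)) = b ^ n * (y * d * w) := by
      linear_combination s2 * e3 + w * hd
    have e5 := mul_left_cancel₀ (pow_ne_zero n hb0) e4
    have : s2 * (s1 * s0 ^ k) ∈ M := by
      rw [e5, mul_assoc]; exact M.mul_mem_right _ hyM
    exact M.primeCompl.mul_mem hs2 (M.primeCompl.mul_mem hs1 (M.primeCompl.pow_mem hs0 k)) this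
  have h1 : a ^ (n + 1) ∈ sat M (J * I ^ n) := hIJ (Ideal.pow_mem_pow haI _)
  have h2 : a ^ (n + 1) ∈ sat M (J * Ideal.span {a} ^ n) :=
    sat_le_of M (mul_sat M (le_sat M J) (pow_sat M hIa n)) h1
  obtain ⟨s, hs, hmem⟩ := h2
  rw [Ideal.span_singleton_pow, mul_comm J, Ideal.mem_span_singleton_mul] at hmem
  obtain ⟨w, hwJ, hw⟩ := hmem
  apply haJ
  refine ⟨s, hs, ?_⟩
  have : a ^ n * (s * a) = a ^ n * w := by rw [hw]; ring
  rwa [mul_left_cancel₀ (pow_ne_zero n ha0) this]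

theorem val_of_basic {𝓜 : Ideal R → Prop} (hp : ∀ M, 𝓜 M → M.IsPrime)
    (H : ∀ I : Ideal R, I ≠ ⊥ → ∀ J : Ideal R, J ≠ ⊥ → J ≤ I →
      (∃ n : ℕ, ∀ M (hM : 𝓜 M), I ^ (n + 1) ≤ @sat _ _ M (hp M hM) (J * I ^ n)) →
      ∀ M (hM : 𝓜 M), I ≤ @sat _ _ M (hp M hM) J)
    (M : Ideal R) (hM : 𝓜 M) (a b : R) :
    (∃ s, s ∉ M ∧ ∃ c, s * b = a * c) ∨ (∃ s, s ∉ M ∧ ∃ c, s * a = b * c) := by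
  have hMp := hp M hM
  by_cases ha0 : a = 0
  · right
    exact ⟨1, M.one_notMem, 0, by simp [ha0]⟩
  have h1 : a * b ∈ sat M (Ideal.span {a ^ 2, b ^ 2}) := by
    refine H (Ideal.span {a ^ 2, a * b, b ^ 2}) ?_ (Ideal.span {a ^ 2, b ^ 2}) ?_ ?_ ?_ M hM ?_
    · intro h
      rw [Ideal.span_eq_bot] at h
      exact ha0 (pow_eq_zero_iff two_ne_zero |>.1 (h (a ^ 2) (by simp)))
    · intro h
      rw [Ideal.span_eq_bot] at h
      exact ha0 (pow_eq_zero_iff two_ne_zero |>.1 (h (a ^ 2) (by simp)))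
    · apply Ideal.span_mono
      intro x hx
      simp at hx ⊢
      tauto
    · refine ⟨1, fun N hN => ?_⟩
      have := hp N hN
      refine le_trans ?_ (le_sat N _)
      rw [pow_one, pow_two]
      set I := Ideal.span {a ^ 2, a * b, b ^ 2} with hI
      set J := Ideal.span {a ^ 2, b ^ 2} with hJ
      have ha : a ^ 2 ∈ I := Ideal.subset_span (by simp)
      have hab : a * b ∈ I := Ideal.subset_span (by simp)
      have hb : b ^ 2 ∈ I := Ideal.subset_span (by simp)
      have ha' : a ^ 2 ∈ J := Ideal.subset_span (by simp)
      have hb' : b ^ 2 ∈ J := Ideal.subset_span (by simp)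
      nth_rewrite 1 [hI]
      nth_rewrite 2 [hI]
      rw [Ideal.span_mul_span', Ideal.span_le]
      rintro _ ⟨x, hx, y, hy, rfl⟩
      simp only [Set.mem_insert_iff, Set.mem_singleton_iff] at hx hy
      simp only [SetLike.mem_coe]
      rcases hx with rfl | rfl | rfl
      · rcases hy with rfl | rfl | rfl
        · exact Ideal.mul_mem_mul ha' ha
        · exact Ideal.mul_mem_mul ha' hab
        · exact Ideal.mul_mem_mul ha' hb
      · rcases hy with rfl | rfl | rfl
        · rw [mul_comm (a * b)]; exact Ideal.mul_mem_mul ha' hab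
        · rw [show a * b * (a * b) = a ^ 2 * b ^ 2 by ring]
          exact Ideal.mul_mem_mul ha' hb
        · rw [mul_comm (a * b)]; exact Ideal.mul_mem_mul hb' hab
      · rcases hy with rfl | rfl | rfl
        · exact Ideal.mul_mem_mul hb' ha
        · exact Ideal.mul_mem_mul hb' hab
        · exact Ideal.mul_mem_mul hb' hb
    · exact Ideal.subset_span (by simp)
  obtain ⟨s, hs, hmem⟩ := h1
  obtain ⟨u, v, huv⟩ := Ideal.mem_span_pair.1 hmem
  have h2 : v * b ∈ sat M (Ideal.span {a}) := by
    refine H (Ideal.span {a, v * b}) ?_ (Ideal.span {a}) ?_ ?_ ?_ M hM ?_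
    · intro h
      rw [Ideal.span_eq_bot] at h
      exact ha0 (h a (by simp))
    · simpa using ha0
    · apply Ideal.span_mono
      simp
    · refine ⟨1, fun N hN => ?_⟩
      have := hp N hN
      refine le_trans ?_ (le_sat N _)
      rw [pow_one, pow_two]
      set I := Ideal.span {a, v * b} with hI
      have ha : a ∈ I := Ideal.subset_span (by simp)
      have hb : v * b ∈ I := Ideal.subset_span (by simp)
      have ha' : a ∈ Ideal.span {a} := Ideal.mem_span_singleton_self a
      nth_rewrite 1 [hI]
      nth_rewrite 2 [hI]
      rw [Ideal.span_mul_span', Ideal.span_le]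
      rintro _ ⟨x, hx, y, hy, rfl⟩
      simp only [Set.mem_insert_iff, Set.mem_singleton_iff] at hx hy
      simp only [SetLike.mem_coe]
      rcases hx with rfl | rfl
      · rcases hy with rfl | rfl
        · exact Ideal.mul_mem_mul ha' ha
        · exact Ideal.mul_mem_mul ha' hb
      · rcases hy with rfl | rfl
        · rw [mul_comm (v * b)]; exact Ideal.mul_mem_mul ha' hb
        · rw [show v * b * (v * b) = a * (s * (v * b) - u * v * a) by
            linear_combination v * huv]
          exact Ideal.mul_mem_mul ha' (I.sub_mem (I.mul_mem_left _ hb) (I.mul_mem_left _ ha))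
    · exact Ideal.subset_span (by simp)
  obtain ⟨q, hq, hmem2⟩ := h2
  obtain ⟨p, hpq⟩ := Ideal.mem_span_singleton'.1 hmem2
  by_cases hpM : p ∈ M
  · left
    refine ⟨s * q - p, ?_, u * q, ?_⟩
    · intro h
      exact M.primeCompl.mul_mem hs hq (by simpa using M.add_mem h hpM)
    · apply mul_left_cancel₀ ha0
      linear_combination (-q) * huv - b * hpq
  · right
    exact ⟨p, hpM, q * v, by rw [hpq]; ring⟩

theorem height_of_basic {𝓜 : Ideal R → Prop} (hp : ∀ M, 𝓜 M → M.IsPrime)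
    (H : ∀ I : Ideal R, I ≠ ⊥ → ∀ J : Ideal R, J ≠ ⊥ → J ≤ I →
      (∃ n : ℕ, ∀ M (hM : 𝓜 M), I ^ (n + 1) ≤ @sat _ _ M (hp M hM) (J * I ^ n)) →
      ∀ M (hM : 𝓜 M), I ≤ @sat _ _ M (hp M hM) J)
    (M : Ideal R) (hM : 𝓜 M) (P : Ideal R) (hP : P.IsPrime) (hPM : P ≤ M) (hP0 : P ≠ ⊥) :
    P = M := by
  have hMp := hp M hM
  have hv := val_of_basic hp H
  by_contra hne
  obtain ⟨x, hxM, hxP⟩ := SetLike.exists_of_lt (lt_of_le_of_ne hPM hne)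
  obtain ⟨a, haP, ha0⟩ := Submodule.exists_mem_ne_zero_of_ne_bot hP0
  have haa : a ∈ Ideal.span {a} := Ideal.mem_span_singleton_self a
  have key : sat P (Ideal.span {a}) ≤ sat M (sat M (Ideal.span {a})) := by
    refine H (sat P (Ideal.span {a})) ?_ (sat M (Ideal.span {a})) ?_ ?_ ⟨1, ?_⟩ M hM
    · intro h
      have := le_sat P _ haa
      rw [h] at this
      exact ha0 (by simpa using this)
    · intro h
      have := le_sat M _ haa
      rw [h] at this
      exact ha0 (by simpa using this)
    · rintro r ⟨s, hs, hr⟩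
      exact ⟨s, fun h => hs (hPM h), hr⟩
    · intro N hN
      have hNp := hp N hN
      rw [pow_one, pow_two, Ideal.mul_le]
      intro r1 hr1 r2 hr2
      by_cases hPN : P ≤ N
      · obtain ⟨q1, hq1, hm1⟩ := hr1
        obtain ⟨q2, hq2, hm2⟩ := hr2
        obtain ⟨p1, hp1⟩ := Ideal.mem_span_singleton'.1 hm1
        obtain ⟨p2, hp2⟩ := Ideal.mem_span_singleton'.1 hm2
        have hq : q1 * q2 ∉ P := P.primeCompl.mul_mem hq1 hq2
        have hq0 : q1 * q2 ≠ 0 := fun h => hq (h ▸ P.zero_mem)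
        rcases hv N hN (q1 * q2) a with ⟨t, ht, c, hc⟩ | ⟨t, ht, c, hc⟩
        · refine ⟨t, ht, ?_⟩
          have e : t * (r1 * r2) = a * (c * (p1 * p2)) := by
            apply mul_left_cancel₀ hq0
            linear_combination (-t * q2 * r2) * hp1 - t * p1 * a * hp2 + a * p1 * p2 * hc
          rw [e]
          refine Ideal.mul_mem_mul (le_sat M _ haa) ⟨q1 * q2, hq, ?_⟩
          exact Ideal.mem_span_singleton'.2 ⟨t * p1 * p2, by linear_combination p1 * p2 * hc⟩
        · exfalso
          refine P.primeCompl.mul_mem (fun h => ht (hPN h) : t ∉ P) hq ?_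
          rw [hc]; exact P.mul_mem_right _ haP
      · obtain ⟨y, hyP, hyN⟩ := SetLike.not_le_iff_exists.1 hPN
        refine ⟨y, hyN, ?_⟩
        rw [← mul_assoc]
        refine Ideal.mul_mem_mul ?_ hr2
        obtain ⟨q1, hq1, hm1⟩ := hr1
        obtain ⟨p1, hp1⟩ := Ideal.mem_span_singleton'.1 hm1
        rcases hv M hM q1 y with ⟨u, hu, c, hc⟩ | ⟨u, hu, c, hc⟩
        · exact ⟨u, hu, Ideal.mem_span_singleton'.2 ⟨c * p1, by
            linear_combination c * hp1 - r1 * hc⟩⟩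
        · exfalso
          refine P.primeCompl.mul_mem (fun h => hu (hPM h) : u ∉ P) hq1 ?_
          rw [hc]; exact P.mul_mem_right _ hyP
  rcases hv M hM x a with ⟨u, hu, c, hc⟩ | ⟨u, hu, c, hc⟩
  · have hcI : c ∈ sat P (Ideal.span {a}) :=
      ⟨x, hxP, Ideal.mem_span_singleton'.2 ⟨u, hc⟩⟩
    obtain ⟨v, hvM, hm⟩ := sat_le_of M le_rfl (key hcI)
    obtain ⟨d, hd⟩ := Ideal.mem_span_singleton'.1 hm
    have e : v * u = x * d := by
      apply mul_left_cancel₀ ha0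
      linear_combination v * hc - x * hd
    refine M.primeCompl.mul_mem hvM hu ?_
    rw [e]; exact M.mul_mem_right _ hxM
  · refine P.primeCompl.mul_mem (fun h => hu (hPM h) : u ∉ P) hxP ?_
    rw [hc]; exact P.mul_mem_right _ haP

end Sat

section Bridge

variable {R : Type*} (K : Type*) [CommRing R] [IsDomain R] [Field K]
  [Algebra R K] [IsFractionRing R K]

theorem mem_locMul (M : Ideal R) [hM : M.IsPrime] (I : Ideal R) (z : K) :
    z ∈ locMul K M ((I : FractionalIdeal R⁰ K) : Submodule R K) ↔
      ∃ t, t ∉ M ∧ ∃ x ∈ I, algebraMap R K t * z = algebraMap R K x := by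
  constructor
  · intro hz
    unfold locMul at hz
    induction hz using Submodule.iSup_induction' with
    | mem t y hy =>
      by_cases ht : t ∈ M
      · simp [ht] at hy
        exact ⟨1, M.one_notMem, 0, I.zero_mem, by simp [hy]⟩
      · simp only [ht, not_false_eq_true, iSup_pos] at hy
        obtain ⟨w, hw, rfl⟩ := Submodule.mem_span_singleton_mul.1 hy
        obtain ⟨x, hx, rfl⟩ := (FractionalIdeal.mem_coeIdeal R⁰).1 hw
        have : algebraMap R K t ≠ 0 := by
          simpa using fun h : t = 0 => ht (h ▸ M.zero_mem)
        exact ⟨t, ht, x, hx, by field_simp⟩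
    | zero => exact ⟨1, M.one_notMem, 0, I.zero_mem, by simp⟩
    | add y z _ _ hy hz =>
      obtain ⟨t, ht, x, hx, e⟩ := hy
      obtain ⟨t', ht', x', hx', e'⟩ := hz
      refine ⟨t * t', M.primeCompl.mul_mem ht ht', t' * x + t * x',
        I.add_mem (I.mul_mem_left _ hx) (I.mul_mem_left _ hx'), ?_⟩
      simp only [map_add, map_mul, ← e, ← e']; ring
  · rintro ⟨t, ht, x, hx, e⟩
    have ht0 : algebraMap R K t ≠ 0 := by
      simpa using fun h : t = 0 => ht (h ▸ M.zero_mem)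
    unfold locMul
    refine (le_iSup_of_le t (le_iSup (fun _ : t ∉ M => Submodule.span R {(algebraMap R K t)⁻¹} *
        ((I : FractionalIdeal R⁰ K) : Submodule R K)) ht) :
      Submodule.span R {(algebraMap R K t)⁻¹} * ((I : FractionalIdeal R⁰ K) : Submodule R K) ≤ _) ?_
    refine Submodule.mem_span_singleton_mul.2 ⟨algebraMap R K x,
      FractionalIdeal.mem_coeIdeal_of_mem _ hx, ?_⟩
    rw [← e]; field_simp

theorem wOp_eq_iff {I J : Ideal R} (hJI : J ≤ I) :
    wOp K (J : FractionalIdeal R⁰ K) = wOp K (I : FractionalIdeal R⁰ K) ↔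
      ∀ M (hM : IsMaxTIdeal K M), I ≤ @sat _ _ M (maxT_isPrime K hM) J := by
  constructor
  · intro h M hM x hx
    have := maxT_isPrime K hM
    have h1 : algebraMap R K x ∈ wOp K (I : FractionalIdeal R⁰ K) := by
      unfold wOp
      simp only [Submodule.mem_iInf]
      intro N hN
      have := maxT_isPrime K hN
      exact (mem_locMul K N I _).2 ⟨1, N.one_notMem, x, hx, by simp⟩
    rw [← h] at h1
    unfold wOp at h1
    simp only [Submodule.mem_iInf] at h1
    obtain ⟨t, ht, y, hy, e⟩ := (mem_locMul K M J _).1 (h1 M hM)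
    refine ⟨t, ht, ?_⟩
    rw [← map_mul] at e
    rwa [IsFractionRing.injective R K e]
  · intro h
    unfold wOp
    refine iInf_congr fun M => iInf_congr fun hM => ?_
    have := maxT_isPrime K hM
    ext z
    rw [mem_locMul, mem_locMul]
    constructor
    · rintro ⟨t, ht, x, hx, e⟩
      exact ⟨t, ht, x, hJI hx, e⟩
    · rintro ⟨t, ht, x, hx, e⟩
      obtain ⟨s, hs, hx'⟩ := h M hM hx
      exact ⟨s * t, M.primeCompl.mul_mem hs ht, s * x, hx', by
        rw [map_mul, map_mul, ← e]; ring⟩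

theorem wOp_red_iff {I J : Ideal R} (hJI : J ≤ I) (n : ℕ) :
    wOp K ((J : FractionalIdeal R⁰ K) * (I : FractionalIdeal R⁰ K) ^ n)
      = wOp K ((I : FractionalIdeal R⁰ K) ^ (n + 1)) ↔
      ∀ M (hM : IsMaxTIdeal K M), I ^ (n + 1) ≤ @sat _ _ M (maxT_isPrime K hM) (J * I ^ n) := by
  rw [← wOp_eq_iff K (by rw [pow_succ']; exact Ideal.mul_mono_left hJI),
    FractionalIdeal.coeIdeal_mul, FractionalIdeal.coeIdeal_pow, FractionalIdeal.coeIdeal_pow]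

theorem height_one_iff (M : Ideal R) (hM : M.IsPrime) :
    Order.height (⟨M, hM⟩ : PrimeSpectrum R) = 1 ↔
      M ≠ ⊥ ∧ ∀ P : Ideal R, P.IsPrime → P ≤ M → P ≠ ⊥ → P = M := by
  have hpos : 0 < Order.height (⟨M, hM⟩ : PrimeSpectrum R) ↔ M ≠ ⊥ := by
    rw [Order.height_pos, isMin_iff_eq_bot, not_iff_not, PrimeSpectrum.ext_iff]
    rfl
  have hle : Order.height (⟨M, hM⟩ : PrimeSpectrum R) ≤ (1 : ℕ) ↔
      ∀ P : Ideal R, P.IsPrime → P ≤ M → P ≠ ⊥ → P = M := by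
    rw [Order.height_le_coe_iff]
    constructor
    · intro h P hP hPM hP0
      by_contra hne
      have := h ⟨P, hP⟩ (lt_of_le_of_ne hPM (fun e => hne (congrArg PrimeSpectrum.asIdeal e)))
      rw [Nat.cast_one, Order.lt_one_iff, Order.height_eq_zero, isMin_iff_eq_bot] at this
      exact hP0 (congrArg PrimeSpectrum.asIdeal this)
    · rintro h ⟨P, hP⟩ hlt
      rw [Nat.cast_one, Order.lt_one_iff, Order.height_eq_zero, isMin_iff_eq_bot]
      by_contra hne
      have := h P hP hlt.le (fun e => hne (PrimeSpectrum.ext e))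
      subst this
      exact lt_irrefl _ hlt
  rw [← hpos, ← hle, le_antisymm_iff, Order.one_le_iff_pos, Nat.cast_one, and_comm]

end Bridge

/-- An integral domain `R` (not a field) has the `w`-basic ideal property (every nonzero ideal
of `R` is `w`-basic) if and only if `R` is a Prüfer `v`-multiplication domain of
`t`-dimension 1, i.e. a PvMD in which every maximal `t`-ideal has height 1. -/
theorem w_basic_iff_isPvMD_tdim_one
    {R K : Type*} [CommRing R] [IsDomain R] [Field K] [Algebra R K] [IsFractionRing R K]
    (hnf : ¬ IsField R) :
    (∀ I : Ideal R, I ≠ ⊥ →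
      ∀ J : Ideal R, J ≠ ⊥ → J ≤ I →
        (∃ n : ℕ, wOp K ((J : FractionalIdeal R⁰ K) * (I : FractionalIdeal R⁰ K) ^ n)
            = wOp K ((I : FractionalIdeal R⁰ K) ^ (n + 1))) →
        wOp K (J : FractionalIdeal R⁰ K) = wOp K (I : FractionalIdeal R⁰ K)) ↔
    (IsPvMD (R := R) K ∧ ∀ M : Ideal R, IsMaxTIdeal K M →
      ∃ hM : M.IsPrime, Order.height (⟨M, hM⟩ : PrimeSpectrum R) = 1) := by

  constructor
  · intro h
    have H : ∀ I : Ideal R, I ≠ ⊥ → ∀ J : Ideal R, J ≠ ⊥ → J ≤ I →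
      (∃ n : ℕ, ∀ M (hM : IsMaxTIdeal K M),
        I ^ (n + 1) ≤ @sat _ _ M (maxT_isPrime K hM) (J * I ^ n)) →
      ∀ M (hM : IsMaxTIdeal K M), I ≤ @sat _ _ M (maxT_isPrime K hM) J := by
      rintro I hI J hJ hJI ⟨n, hn⟩
      exact (wOp_eq_iff K hJI).1 (h I hI J hJ hJI ⟨n, (wOp_red_iff K hJI n).2 hn⟩)
    refine ⟨isPvMD_of_val K hnf (val_of_basic (fun M hM => maxT_isPrime K hM) H), fun M hM => ?_⟩
    refine ⟨maxT_isPrime K hM, (height_one_iff M _).2 ⟨maxT_ne_bot K hnf hM, ?_⟩⟩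
    exact height_of_basic (fun M hM => maxT_isPrime K hM) H M hM
  · rintro ⟨hP, hh⟩ I hI J hJ hJI ⟨n, hn⟩
    rw [wOp_eq_iff K hJI]
    intro M hM
    obtain ⟨hMp, hht⟩ := hh M hM
    exact basic_local M ((height_one_iff M hMp).1 hht).2 (val_of_isPvMD K hP hM) n
      ((wOp_red_iff K hJI n).1 hn M hM)
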